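/- Let F be a set of density matrices on ℂ^d. For every finite family of density matrices {ρ_k} on ℂ^d and every probability distribution {p_k}, the free encoding capacity satisfies C_F(Σ_k p_k ρ_k) ≤ Σ_k p_k C_F(ρ_k); that is, C_F is convex on density matrices. -/

import Mathlib

open scoped BigOperators ComplexOrder Matrix

namespace FECpaper

/-- Square complex matrices of size `d`, the ambient space for states on `ℂ^d`. -/
abbrev Mat (d : ℕ) := Matrix (Fin d) (Fin d) ℂ

/-- A density matrix: positive semidefinite with unit trace. -/
def IsDensityMatrix {d : ℕ} (ρ : Mat d) : Prop := ρ.PosSemidef ∧ ρ.trace = 1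

/-- Von Neumann entropy (base 2), via eigenvalues; junk value `0` for non-Hermitian input.
Note `Real.logb 2 0 = 0`, so the convention `0 · log₂ 0 = 0` holds automatically. -/
noncomputable def entropy {d : ℕ} (ρ : Mat d) : ℝ :=
  if h : ρ.IsHermitian then -∑ i, h.eigenvalues i * Real.logb 2 (h.eigenvalues i) else 0

/-- A quantum channel: a map admitting a Kraus representation with `∑ k, (L k)ᴴ * L k = 1`. -/
def IsChannel {d : ℕ} (N : Mat d → Mat d) : Prop :=
  ∃ (n : ℕ) (L : Fin n → Mat d),
    (∑ k, (L k)ᴴ * L k) = 1 ∧ ∀ A, N A = ∑ k, L k * A * (L k)ᴴ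

/-- A free channel for the set `F` of free states: a channel mapping `F` into `F`. -/
def IsFreeChannel {d : ℕ} (F : Set (Mat d)) (N : Mat d → Mat d) : Prop :=
  IsChannel N ∧ ∀ σ ∈ F, N σ ∈ F

/-- A (finitely supported) probability distribution. -/
def IsProb {ι : Type*} [Fintype ι] (p : ι → ℝ) : Prop :=
  (∀ x, 0 ≤ p x) ∧ ∑ x, p x = 1

/-- Holevo quantity of a finite ensemble of states:
`χ = S(∑ₓ pₓ ρₓ) − ∑ₓ pₓ S(ρₓ)`. -/
noncomputable def holevo {d : ℕ} {ι : Type*} [Fintype ι] (p : ι → ℝ) (ρs : ι → Mat d) : ℝ :=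
  entropy (∑ x, p x • ρs x) - ∑ x, p x * entropy (ρs x)

/-- Free encoding capacity of a state `ρ` for the resource theory with free states `F`:
the supremum of Holevo quantities of ensembles obtained from `ρ` by free channels. -/
noncomputable def FEC {d : ℕ} (F : Set (Mat d)) (ρ : Mat d) : ℝ :=
  sSup {c : ℝ | ∃ (n : ℕ) (p : Fin n → ℝ) (N : Fin n → (Mat d → Mat d)),
    IsProb p ∧ (∀ x, IsFreeChannel F (N x)) ∧ c = holevo p (fun x => N x ρ)}

/-- A stochastically free operation: a Kraus family with `∑ k, (L k)ᴴ * L k = 1` each of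
whose members maps every free state to a nonnegative scalar multiple of a free state. -/
def IsStochFree {d : ℕ} (F : Set (Mat d)) {n : ℕ} (L : Fin n → Mat d) : Prop :=
  (∑ k, (L k)ᴴ * L k) = 1 ∧
  ∀ k, ∀ σ ∈ F, ∃ (c : ℝ) (τ : Mat d), 0 ≤ c ∧ τ ∈ F ∧ L k * σ * (L k)ᴴ = c • τ

/-- Spectral data: `A = U diag(l) Uᴴ` with `U` unitary. -/
def Spec {d : ℕ} (A U : Mat d) (l : Fin d → ℝ) : Prop :=
  Uᴴ * U = 1 ∧ U * Uᴴ = 1 ∧ A = U * Matrix.diagonal (fun i => (l i : ℂ)) * Uᴴ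

lemma spec_of_herm {d : ℕ} {A : Mat d} (h : A.IsHermitian) :
    Spec A (h.eigenvectorUnitary : Mat d) h.eigenvalues := by
  refine ⟨?_, ?_, ?_⟩
  · exact Matrix.mem_unitaryGroup_iff'.1 h.eigenvectorUnitary.2
  · exact Matrix.mem_unitaryGroup_iff.1 h.eigenvectorUnitary.2
  · conv_lhs => rw [h.spectral_theorem]
    rfl

/-- Variational functional. -/
noncomputable def G {d : ℕ} (s : ℝ) (Y A B : Mat d) : ℝ :=
  2 * (Matrix.trace (Yᴴ * A)).re - (Matrix.trace (Yᴴ * B * Y)).re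
    - s * (Matrix.trace (Yᴴ * Y * A)).re

lemma G_eq {d : ℕ} (s : ℝ) {A B U V : Mat d} {l μ : Fin d → ℝ} (hA : Spec A U l)
    (hB : Spec B V μ) (Z : Mat d) :
    G s (V * Z * Uᴴ) A B = ∑ j, ∑ i,
      (2 * (star (Z j i) * (Vᴴ * U) j i).re * l i - (s * l i + μ j) * Complex.normSq (Z j i)) := by
  obtain ⟨hU, hU', rfl⟩ := hA
  obtain ⟨hV, hV', rfl⟩ := hB
  have hUr : ∀ X, Uᴴ * (U * X) = X := fun X => by rw [← mul_assoc, hU, one_mul]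
  have hVr : ∀ X, Vᴴ * (V * X) = X := fun X => by rw [← mul_assoc, hV, one_mul]
  have e1 : Matrix.trace ((V * Z * Uᴴ)ᴴ * (U * Matrix.diagonal (fun i => (l i : ℂ)) * Uᴴ))
      = ∑ j, ∑ i, star (Z j i) * (Vᴴ * U) j i * l i := by
    have : (V * Z * Uᴴ)ᴴ * (U * Matrix.diagonal (fun i => (l i : ℂ)) * Uᴴ)
        = U * (Zᴴ * (Vᴴ * U) * Matrix.diagonal (fun i => (l i : ℂ)) * Uᴴ) := by
      simp [mul_assoc]
    rw [this, Matrix.trace_mul_comm, mul_assoc, hU, mul_one, Matrix.trace, Finset.sum_comm]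
    refine Finset.sum_congr rfl fun i _ => ?_
    rw [Matrix.diag_apply, Matrix.mul_diagonal, Matrix.mul_apply, Finset.sum_mul]
    rfl
  have e2 : Matrix.trace ((V * Z * Uᴴ)ᴴ * (V * Matrix.diagonal (fun i => (μ i : ℂ)) * Vᴴ) *
      (V * Z * Uᴴ)) = ∑ j, ∑ i, ((μ j * Complex.normSq (Z j i) : ℝ) : ℂ) := by
    have : (V * Z * Uᴴ)ᴴ * (V * Matrix.diagonal (fun i => (μ i : ℂ)) * Vᴴ) * (V * Z * Uᴴ)
        = U * (Zᴴ * (Matrix.diagonal (fun i => (μ i : ℂ)) * Z) * Uᴴ) := by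
      simp [mul_assoc, hVr, hUr]
    rw [this, Matrix.trace_mul_comm, mul_assoc, hU, mul_one, Matrix.trace, Finset.sum_comm]
    refine Finset.sum_congr rfl fun i _ => ?_
    rw [Matrix.diag_apply, Matrix.mul_apply]
    refine Finset.sum_congr rfl fun j _ => ?_
    rw [Matrix.diagonal_mul, Matrix.conjTranspose_apply]
    push_cast
    rw [Complex.normSq_eq_conj_mul_self]
    simp only [RCLike.star_def]
    ring
  have e3 : Matrix.trace ((V * Z * Uᴴ)ᴴ * (V * Z * Uᴴ) *
      (U * Matrix.diagonal (fun i => (l i : ℂ)) * Uᴴ)) =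
      ∑ j, ∑ i, ((l i * Complex.normSq (Z j i) : ℝ) : ℂ) := by
    have : (V * Z * Uᴴ)ᴴ * (V * Z * Uᴴ) * (U * Matrix.diagonal (fun i => (l i : ℂ)) * Uᴴ)
        = U * (Zᴴ * (Z * Matrix.diagonal (fun i => (l i : ℂ))) * Uᴴ) := by
      simp [mul_assoc, hVr, hUr]
    rw [this, Matrix.trace_mul_comm, mul_assoc, hU, mul_one, Matrix.trace, Finset.sum_comm]
    refine Finset.sum_congr rfl fun i _ => ?_
    rw [Matrix.diag_apply, Matrix.mul_apply]
    refine Finset.sum_congr rfl fun j _ => ?_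
    rw [Matrix.mul_diagonal, Matrix.conjTranspose_apply]
    push_cast
    rw [Complex.normSq_eq_conj_mul_self]
    simp only [RCLike.star_def]
    ring
  rw [G, e1, e2, e3]
  simp only [Complex.re_sum, Complex.ofReal_re, Complex.re_mul_ofReal, Finset.mul_sum,
    ← Finset.sum_sub_distrib]
  refine Finset.sum_congr rfl fun j _ => Finset.sum_congr rfl fun i _ => ?_
  ring

/-- The quadratic-form value in coordinates. -/
noncomputable def q {d : ℕ} (s : ℝ) (m : Mat d) (l μ : Fin d → ℝ) : ℝ :=
  ∑ j, ∑ i, Complex.normSq (m j i) * l i ^ 2 / (s * l i + μ j)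

lemma G_le {d : ℕ} {s : ℝ} (hs : 0 < s) {A B U V : Mat d} {l μ : Fin d → ℝ} (hA : Spec A U l)
    (hB : Spec B V μ) (hl : ∀ i, 0 ≤ l i) (hμ : ∀ i, 0 ≤ μ i) (Y : Mat d) :
    G s Y A B ≤ q s (Vᴴ * U) l μ := by
  have : Y = V * (Vᴴ * Y * U) * Uᴴ := by
    have h1 := hA.2.1
    have h2 := hB.2.1
    calc Y = (V * Vᴴ) * Y * (U * Uᴴ) := by rw [h1, h2]; simp
      _ = _ := by simp only [mul_assoc]
  rw [this, G_eq s hA hB]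
  refine Finset.sum_le_sum fun j _ => Finset.sum_le_sum fun i _ => ?_
  generalize (Vᴴ * Y * U) j i = z
  generalize (Vᴴ * U) j i = m
  rcases (hl i).eq_or_lt with h | h
  · rw [← h]
    have := mul_nonneg (hμ j) (Complex.normSq_nonneg z)
    simp; exact this
  · have hc : 0 < s * l i + μ j := add_pos_of_pos_of_nonneg (mul_pos hs h) (hμ j)
    rw [le_div_iff₀ hc]
    generalize s * l i + μ j = c at *
    simp only [Complex.normSq_apply, RCLike.star_def, Complex.mul_re, Complex.conj_re,
      Complex.conj_im]
    nlinarith [sq_nonneg (c * z.re - l i * m.re), sq_nonneg (c * z.im - l i * m.im)]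

lemma exists_G {d : ℕ} {s : ℝ} (hs : 0 < s) {A B U V : Mat d} {l μ : Fin d → ℝ} (hA : Spec A U l)
    (hB : Spec B V μ) (hl : ∀ i, 0 ≤ l i) (hμ : ∀ i, 0 ≤ μ i) :
    ∃ Y, G s Y A B = q s (Vᴴ * U) l μ := by
  refine ⟨V * (Matrix.of fun j i => (Vᴴ * U) j i * ((l i / (s * l i + μ j) : ℝ) : ℂ)) * Uᴴ, ?_⟩
  rw [G_eq s hA hB]
  refine Finset.sum_congr rfl fun j _ => Finset.sum_congr rfl fun i _ => ?_
  simp only [Matrix.of_apply]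
  generalize (Vᴴ * U) j i = m
  rcases (hl i).eq_or_lt with h | h
  · rw [← h]
    simp
  · have hc : 0 < s * l i + μ j := add_pos_of_pos_of_nonneg (mul_pos hs h) (hμ j)
    generalize s * l i + μ j = c at *
    simp only [Complex.normSq_apply, RCLike.star_def, Complex.mul_re, Complex.conj_re,
      Complex.conj_im, Complex.mul_im, Complex.ofReal_re, Complex.ofReal_im]
    field_simp
    ring

lemma G_sum {d n : ℕ} (s : ℝ) (Y : Mat d) (p : Fin n → ℝ) (A B : Fin n → Mat d) :
    G s Y (∑ k, p k • A k) (∑ k, p k • B k) = ∑ k, p k * G s Y (A k) (B k) := by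
  simp only [G, Matrix.mul_sum, Matrix.sum_mul, Matrix.trace_sum, Complex.re_sum,
    Matrix.mul_smul, Matrix.smul_mul, Matrix.trace_smul, Complex.smul_re, Finset.mul_sum,
    ← Finset.sum_sub_distrib, smul_eq_mul]
  refine Finset.sum_congr rfl fun k _ => ?_
  ring

lemma q_convex {d n : ℕ} {s : ℝ} (hs : 0 < s) {p : Fin n → ℝ} (hp : ∀ k, 0 ≤ p k)
    {A B U V : Fin n → Mat d} {l μ : Fin n → Fin d → ℝ}
    (hA : ∀ k, Spec (A k) (U k) (l k)) (hB : ∀ k, Spec (B k) (V k) (μ k))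
    (hl : ∀ k i, 0 ≤ l k i) (hμ : ∀ k i, 0 ≤ μ k i)
    {U0 V0 : Mat d} {l0 μ0 : Fin d → ℝ} (hA0 : Spec (∑ k, p k • A k) U0 l0)
    (hB0 : Spec (∑ k, p k • B k) V0 μ0) (hl0 : ∀ i, 0 ≤ l0 i) (hμ0 : ∀ i, 0 ≤ μ0 i) :
    q s (V0ᴴ * U0) l0 μ0 ≤ ∑ k, p k * q s ((V k)ᴴ * U k) (l k) (μ k) := by
  obtain ⟨Y, hY⟩ := exists_G hs hA0 hB0 hl0 hμ0
  rw [← hY, G_sum]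
  exact Finset.sum_le_sum fun k _ =>
    mul_le_mul_of_nonneg_left (G_le hs (hA k) (hB k) (hl k) (hμ k) Y) (hp k)

/-- The primitive of `q`. -/
noncomputable def Q {d : ℕ} (T : ℝ) (m : Mat d) (l μ : Fin d → ℝ) : ℝ :=
  ∑ j, ∑ i, Complex.normSq (m j i) * l i * (Real.log (T * l i + μ j) - Real.log (μ j))

/-- Relative entropy in coordinates (natural logarithm). -/
noncomputable def D {d : ℕ} (m : Mat d) (l μ : Fin d → ℝ) : ℝ :=
  ∑ j, ∑ i, Complex.normSq (m j i) * l i * (Real.log (l i) - Real.log (μ j))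

/-- Support condition. -/
def Supp {d : ℕ} (m : Mat d) (l μ : Fin d → ℝ) : Prop :=
  ∀ j i, μ j = 0 → Complex.normSq (m j i) * l i = 0

lemma Q_zero {d : ℕ} (m : Mat d) (l μ : Fin d → ℝ) : Q 0 m l μ = 0 := by simp [Q]

lemma Q_cont {d : ℕ} {m : Mat d} {l μ : Fin d → ℝ} (hl : ∀ i, 0 ≤ l i) (hμ : ∀ i, 0 ≤ μ i)
    (h : Supp m l μ) : ContinuousOn (fun T => Q T m l μ) (Set.Ici 0) := by
  unfold Q
  refine continuousOn_finsetSum _ fun j _ => continuousOn_finsetSum _ fun i _ => ?_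
  rcases (hμ j).eq_or_lt with h0 | h0
  · simp only [h j i h0.symm, zero_mul]
    exact continuousOn_const
  · refine continuousOn_const.mul (ContinuousOn.sub ?_ continuousOn_const)
    refine ContinuousOn.log (by fun_prop) ?_
    intro T hT
    have := mul_nonneg (Set.mem_Ici.1 hT) (hl i)
    positivity

lemma Q_deriv {d : ℕ} (m : Mat d) {l μ : Fin d → ℝ} (hl : ∀ i, 0 ≤ l i) (hμ : ∀ i, 0 ≤ μ i)
    {T : ℝ} (hT : 0 < T) : HasDerivAt (fun T => Q T m l μ) (q T m l μ) T := by
  unfold Q q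
  refine HasDerivAt.fun_sum fun j _ => HasDerivAt.fun_sum fun i _ => ?_
  rcases (hl i).eq_or_lt with h0 | h0
  · simp only [← h0, mul_zero, zero_mul, ne_eq, OfNat.ofNat_ne_zero, not_false_eq_true, zero_pow,
      zero_div]
    exact hasDerivAt_const _ _
  · have hc : T * l i + μ j ≠ 0 := (add_pos_of_pos_of_nonneg (mul_pos hT h0) (hμ j)).ne'
    have h1 : HasDerivAt (fun T : ℝ => T * l i + μ j) (l i) T := by
      simpa using ((hasDerivAt_id T).mul_const (l i)).add_const (μ j)
    have h2 := ((h1.log hc).sub_const (Real.log (μ j))).const_mul (Complex.normSq (m j i) * l i)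
    refine h2.congr_deriv ?_
    rw [pow_two, mul_assoc, mul_div_assoc, mul_div_assoc]

lemma sum_normSq {d : ℕ} {U V : Mat d} (hU : Uᴴ * U = 1) (hV : V * Vᴴ = 1) (i : Fin d) :
    ∑ j, Complex.normSq ((Vᴴ * U) j i) = 1 := by
  have h : (Vᴴ * U)ᴴ * (Vᴴ * U) = 1 := by
    calc (Vᴴ * U)ᴴ * (Vᴴ * U) = Uᴴ * (V * Vᴴ) * U := by simp [mul_assoc]
      _ = 1 := by rw [hV, mul_one, hU]
  have h' := congrFun (congrFun h i) i
  rw [Matrix.mul_apply, Matrix.one_apply_eq] at h'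
  have : ((∑ j, Complex.normSq ((Vᴴ * U) j i) : ℝ) : ℂ) = 1 := by
    rw [← h']
    push_cast
    refine Finset.sum_congr rfl fun j _ => ?_
    rw [Complex.normSq_eq_conj_mul_self, Matrix.conjTranspose_apply]
    rfl
  exact_mod_cast this

lemma Q_tendsto {d : ℕ} {U V : Mat d} (hU : Uᴴ * U = 1) (hV : V * Vᴴ = 1)
    {l μ : Fin d → ℝ} (hl : ∀ i, 0 ≤ l i) :
    Filter.Tendsto (fun T => Q T (Vᴴ * U) l μ - (∑ i, l i) * Real.log T) Filter.atTop
      (nhds (D (Vᴴ * U) l μ)) := by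
  have e : ∀ T, Q T (Vᴴ * U) l μ - (∑ i, l i) * Real.log T = ∑ j, ∑ i,
      Complex.normSq ((Vᴴ * U) j i) * l i *
        ((Real.log (T * l i + μ j) - Real.log T) - Real.log (μ j)) := by
    intro T
    have : ∑ i, l i = ∑ j, ∑ i, Complex.normSq ((Vᴴ * U) j i) * l i := by
      rw [Finset.sum_comm]
      refine Finset.sum_congr rfl fun i _ => ?_
      rw [← Finset.sum_mul, sum_normSq hU hV, one_mul]
    rw [this, Q]
    simp only [Finset.sum_mul, ← Finset.sum_sub_distrib]
    refine Finset.sum_congr rfl fun j _ => Finset.sum_congr rfl fun i _ => ?_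
    ring
  simp only [e]
  unfold D
  refine tendsto_finsetSum _ fun j _ => tendsto_finsetSum _ fun i _ => ?_
  rcases (hl i).eq_or_lt with h0 | h0
  · simp [← h0]
  · refine Filter.Tendsto.const_mul _ (Filter.Tendsto.sub_const ?_ _)
    have h1 : Filter.Tendsto (fun T : ℝ => l i + μ j * T⁻¹) Filter.atTop (nhds (l i)) := by
      simpa using (tendsto_inv_atTop_zero.const_mul (μ j)).const_add (l i)
    have h2 := (Real.continuousAt_log h0.ne').tendsto.comp h1
    refine h2.congr' ?_
    filter_upwards [Filter.eventually_gt_atTop 0, h1.eventually (lt_mem_nhds h0)] with T hT hT2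
    simp only [Function.comp]
    rw [eq_sub_iff_add_eq, ← Real.log_mul hT2.ne' hT.ne']
    congr 1
    field_simp

lemma D_convex {d n : ℕ} {p : Fin n → ℝ} (hp : ∀ k, 0 ≤ p k)
    {A B U V : Fin n → Mat d} {l μ : Fin n → Fin d → ℝ}
    (hA : ∀ k, Spec (A k) (U k) (l k)) (hB : ∀ k, Spec (B k) (V k) (μ k))
    (hl : ∀ k i, 0 ≤ l k i) (hμ : ∀ k i, 0 ≤ μ k i)
    (hS : ∀ k, Supp ((V k)ᴴ * U k) (l k) (μ k))
    {U0 V0 : Mat d} {l0 μ0 : Fin d → ℝ} (hA0 : Spec (∑ k, p k • A k) U0 l0)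
    (hB0 : Spec (∑ k, p k • B k) V0 μ0) (hl0 : ∀ i, 0 ≤ l0 i) (hμ0 : ∀ i, 0 ≤ μ0 i)
    (hS0 : Supp (V0ᴴ * U0) l0 μ0) (htr : ∑ i, l0 i = ∑ k, p k * ∑ i, l k i) :
    D (V0ᴴ * U0) l0 μ0 ≤ ∑ k, p k * D ((V k)ᴴ * U k) (l k) (μ k) := by
  have key : ∀ T : ℝ, 0 ≤ T →
      Q T (V0ᴴ * U0) l0 μ0 ≤ ∑ k, p k * Q T ((V k)ᴴ * U k) (l k) (μ k) := by
    have mono : MonotoneOn (fun T => ∑ k, p k * Q T ((V k)ᴴ * U k) (l k) (μ k)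
        - Q T (V0ᴴ * U0) l0 μ0) (Set.Ici 0) := by
      have hd : ∀ T : ℝ, 0 < T → HasDerivAt (fun T => ∑ k, p k * Q T ((V k)ᴴ * U k) (l k) (μ k)
        - Q T (V0ᴴ * U0) l0 μ0) (∑ k, p k * q T ((V k)ᴴ * U k) (l k) (μ k)
        - q T (V0ᴴ * U0) l0 μ0) T := fun T hT =>
        (HasDerivAt.fun_sum fun k _ => (Q_deriv _ (hl k) (hμ k) hT).const_mul (p k)).sub
          (Q_deriv _ hl0 hμ0 hT)
      refine monotoneOn_of_deriv_nonneg (convex_Ici 0) ?_ ?_ ?_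
      · exact (continuousOn_finsetSum _ fun k _ =>
          continuousOn_const.mul (Q_cont (hl k) (hμ k) (hS k))).sub (Q_cont hl0 hμ0 hS0)
      · rw [interior_Ici]
        exact fun T hT => (hd T hT).differentiableAt.differentiableWithinAt
      · rw [interior_Ici]
        intro T hT
        rw [(hd T hT).deriv]
        exact sub_nonneg.2 (q_convex hT hp hA hB hl hμ hA0 hB0 hl0 hμ0)
    intro T hT
    have := mono (Set.mem_Ici.2 le_rfl) (Set.mem_Ici.2 hT) hT
    simp only [Q_zero, mul_zero, Finset.sum_const_zero, sub_zero] at this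
    exact sub_nonneg.1 this
  have t0 := Q_tendsto (μ := μ0) hA0.1 hB0.2.1 hl0
  have t1 := tendsto_finsetSum Finset.univ fun k _ =>
    (Q_tendsto (μ := μ k) (hA k).1 (hB k).2.1 (hl k)).const_mul (p k)
  refine le_of_tendsto_of_tendsto t0 t1 ?_
  filter_upwards [Filter.eventually_ge_atTop 0] with T hT
  have := key T hT
  simp only [mul_sub, Finset.sum_sub_distrib, ← mul_assoc, ← Finset.sum_mul]
  rw [htr]
  linarith

lemma spec_diag {d : ℕ} {A U : Mat d} {l : Fin d → ℝ} (hA : Spec A U l) (V : Mat d) (j : Fin d) :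
    (Vᴴ * A * V) j j = ((∑ i, Complex.normSq ((Vᴴ * U) j i) * l i : ℝ) : ℂ) := by
  obtain ⟨hU, hU', rfl⟩ := hA
  have : Vᴴ * (U * Matrix.diagonal (fun i => (l i : ℂ)) * Uᴴ) * V
      = (Vᴴ * U) * Matrix.diagonal (fun i => (l i : ℂ)) * (Vᴴ * U)ᴴ := by
    simp [mul_assoc]
  rw [this, Matrix.mul_apply]
  push_cast
  refine Finset.sum_congr rfl fun i _ => ?_
  rw [Matrix.mul_diagonal, Matrix.conjTranspose_apply, Complex.normSq_eq_conj_mul_self]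
  simp only [RCLike.star_def]
  ring

lemma sum_diag {d n : ℕ} {p : Fin n → ℝ} {A U : Fin n → Mat d} {l : Fin n → Fin d → ℝ}
    (hA : ∀ x, Spec (A x) (U x) (l x)) {V : Mat d} {μ : Fin d → ℝ}
    (hB : Spec (∑ x, p x • A x) V μ) (j : Fin d) :
    ∑ x, p x * ∑ i, Complex.normSq ((Vᴴ * U x) j i) * l x i = μ j := by
  have h1 : Vᴴ * (∑ x, p x • A x) * V = Matrix.diagonal (fun i => (μ i : ℂ)) := by
    obtain ⟨hV, -, h⟩ := hB
    rw [h]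
    calc _ = (Vᴴ * V) * Matrix.diagonal (fun i => (μ i : ℂ)) * (Vᴴ * V) := by
          simp only [mul_assoc]
      _ = _ := by rw [hV, one_mul, mul_one]
  have h2 := congrFun (congrFun h1 j) j
  rw [Matrix.diagonal_apply_eq] at h2
  simp only [Matrix.mul_sum, Matrix.sum_mul, Matrix.mul_smul, Matrix.smul_mul, Matrix.sum_apply,
    Matrix.smul_apply] at h2
  simp only [spec_diag (hA _) V j, Complex.real_smul] at h2
  exact_mod_cast h2

lemma supp_of {d n : ℕ} {p : Fin n → ℝ} (hp : ∀ x, 0 ≤ p x)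
    {A U : Fin n → Mat d} {l : Fin n → Fin d → ℝ}
    (hA : ∀ x, Spec (A x) (U x) (l x)) (hl : ∀ x i, 0 ≤ l x i) {V : Mat d} {μ : Fin d → ℝ}
    (hB : Spec (∑ x, p x • A x) V μ) {x : Fin n} (hx : 0 < p x) :
    Supp (Vᴴ * U x) (l x) μ := by
  intro j i hj
  have h := sum_diag hA hB j
  have nn : ∀ x i, 0 ≤ Complex.normSq ((Vᴴ * U x) j i) * l x i :=
    fun x i => mul_nonneg (Complex.normSq_nonneg _) (hl x i)
  rw [hj, Finset.sum_eq_zero_iff_of_nonneg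
    (fun x _ => mul_nonneg (hp x) (Finset.sum_nonneg fun i _ => nn x i))] at h
  have h2 := (mul_eq_zero.1 (h x (Finset.mem_univ _))).resolve_left hx.ne'
  rw [Finset.sum_eq_zero_iff_of_nonneg (fun i _ => nn x i)] at h2
  exact h2 i (Finset.mem_univ _)

lemma entropy_mul_log {d : ℕ} {A : Mat d} (h : A.IsHermitian) :
    entropy A * Real.log 2 = -∑ i, h.eigenvalues i * Real.log (h.eigenvalues i) := by
  have : Real.log 2 ≠ 0 := (Real.log_pos one_lt_two).ne'
  rw [entropy, dif_pos h, neg_mul, Finset.sum_mul]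
  congr 1
  refine Finset.sum_congr rfl fun i _ => ?_
  rw [Real.logb]
  field_simp

lemma D_eq {d : ℕ} {U V : Mat d} (hU : Uᴴ * U = 1) (hV : V * Vᴴ = 1) (l μ : Fin d → ℝ) :
    D (Vᴴ * U) l μ = ∑ i, l i * Real.log (l i)
      - ∑ j, (∑ i, Complex.normSq ((Vᴴ * U) j i) * l i) * Real.log (μ j) := by
  have h : ∑ i, l i * Real.log (l i)
      = ∑ j, ∑ i, Complex.normSq ((Vᴴ * U) j i) * (l i * Real.log (l i)) := by
    rw [Finset.sum_comm]
    refine Finset.sum_congr rfl fun i _ => ?_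
    rw [← Finset.sum_mul, sum_normSq hU hV, one_mul]
  rw [h, D]
  simp only [Finset.sum_mul, ← Finset.sum_sub_distrib]
  refine Finset.sum_congr rfl fun j _ => Finset.sum_congr rfl fun i _ => ?_
  ring

lemma holevo_eq {d n : ℕ} (p : Fin n → ℝ) {A : Fin n → Mat d} (hA : ∀ x, (A x).IsHermitian)
    (hB : (∑ x, p x • A x).IsHermitian) :
    holevo p A * Real.log 2 = ∑ x, p x * D ((hB.eigenvectorUnitary : Mat d)ᴴ *
      ((hA x).eigenvectorUnitary : Mat d)) (hA x).eigenvalues hB.eigenvalues := by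
  have hs := sum_diag (fun x => spec_of_herm (hA x)) (spec_of_herm hB)
  rw [holevo, sub_mul, entropy_mul_log hB, Finset.sum_mul]
  simp only [D_eq (spec_of_herm (hA _)).1 (spec_of_herm hB).2.1, mul_assoc,
    entropy_mul_log (hA _), mul_sub, Finset.sum_sub_distrib]
  have : ∑ j, hB.eigenvalues j * Real.log (hB.eigenvalues j) = ∑ x, p x * ∑ j,
      (∑ i, Complex.normSq (((hB.eigenvectorUnitary : Mat d)ᴴ *
      ((hA x).eigenvectorUnitary : Mat d)) j i) * (hA x).eigenvalues i) *
        Real.log (hB.eigenvalues j) := by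
    simp only [Finset.mul_sum (Finset.univ) _ (p _)]
    rw [Finset.sum_comm]
    refine Finset.sum_congr rfl fun j _ => ?_
    simp only [← mul_assoc]
    rw [← Finset.sum_mul]
    congr 1
    exact (hs j).symm
  rw [this]
  simp only [mul_neg, Finset.sum_neg_distrib]
  ring

lemma re_trace {d : ℕ} {A : Mat d} (h : A.IsHermitian) :
    A.trace.re = ∑ i, h.eigenvalues i := by
  have h1 := congrArg Complex.re h.trace_eq_sum_eigenvalues
  rw [h1, Complex.re_sum]
  rfl

lemma psd_sum {d n : ℕ} {p : Fin n → ℝ} (hp : ∀ x, 0 ≤ p x) {A : Fin n → Mat d}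
    (hA : ∀ x, (A x).PosSemidef) : (∑ x, p x • A x).PosSemidef :=
  Matrix.posSemidef_sum _ fun x _ => (hA x).smul (hp x)

lemma holevo_convex {d n N : ℕ} {p : Fin n → ℝ} (hp : ∀ x, 0 ≤ p x) {r : Fin N → ℝ}
    (hr : ∀ k, 0 ≤ r k) {A : Fin N → Fin n → Mat d} (hA : ∀ k x, (A k x).PosSemidef) :
    holevo p (fun x => ∑ k, r k • A k x) ≤ ∑ k, r k * holevo p (A k) := by
  have hA0 : ∀ x, (∑ k, r k • A k x).PosSemidef := fun x => psd_sum hr fun k => hA k x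
  have hB : ∀ k, (∑ x, p x • A k x).PosSemidef := fun k => psd_sum hp (hA k)
  have hB0 : (∑ x, p x • ∑ k, r k • A k x).PosSemidef := psd_sum hp hA0
  have hBe : ∑ x, p x • ∑ k, r k • A k x = ∑ k, r k • ∑ x, p x • A k x := by
    simp only [Finset.smul_sum]
    rw [Finset.sum_comm]
    refine Finset.sum_congr rfl fun k _ => Finset.sum_congr rfl fun x _ => smul_comm _ _ _
  have hlog : 0 < Real.log 2 := Real.log_pos one_lt_two
  refine le_of_mul_le_mul_right ?_ hlog
  rw [holevo_eq p (fun x => (hA0 x).1) hB0.1, Finset.sum_mul]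
  simp only [mul_assoc]
  simp only [holevo_eq p (fun x => (hA _ x).1) (hB _).1, Finset.mul_sum]
  rw [Finset.sum_comm]
  refine Finset.sum_le_sum fun x _ => ?_
  rcases (hp x).eq_or_lt with h0 | h0
  · simp [← h0]
  have key := D_convex hr (A := fun k => A k x) (B := fun k => ∑ x, p x • A k x)
    (fun k => spec_of_herm (hA k x).1) (fun k => spec_of_herm (hB k).1)
    (fun k => (hA k x).eigenvalues_nonneg) (fun k => (hB k).eigenvalues_nonneg)
    (fun k => supp_of hp (fun x => spec_of_herm (hA k x).1)
      (fun x => (hA k x).eigenvalues_nonneg) (spec_of_herm (hB k).1) h0)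
    (spec_of_herm (hA0 x).1) (by rw [← hBe]; exact spec_of_herm hB0.1)
    (hA0 x).eigenvalues_nonneg hB0.eigenvalues_nonneg
    (supp_of hp (fun x => spec_of_herm (hA0 x).1)
      (fun x => (hA0 x).eigenvalues_nonneg) (spec_of_herm hB0.1) h0) ?_
  · have := mul_le_mul_of_nonneg_left key h0.le
    rw [Finset.mul_sum] at this
    refine this.trans (le_of_eq ?_)
    refine Finset.sum_congr rfl fun k _ => ?_
    ring
  · simp only [← re_trace, Matrix.trace_sum, Matrix.trace_smul, Complex.re_sum, Complex.smul_re,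
      smul_eq_mul]

lemma channel_density {d : ℕ} {N : Mat d → Mat d} (hN : IsChannel N) {ρ : Mat d}
    (hρ : IsDensityMatrix ρ) : IsDensityMatrix (N ρ) := by
  obtain ⟨n, L, hL, h⟩ := hN
  rw [h]
  refine ⟨Matrix.posSemidef_sum _ fun k _ => hρ.1.mul_mul_conjTranspose_same _, ?_⟩
  rw [Matrix.trace_sum]
  have : ∀ k, (L k * ρ * (L k)ᴴ).trace = ((L k)ᴴ * L k * ρ).trace := fun k => by
    rw [Matrix.trace_mul_comm, mul_assoc]
  simp only [this]
  rw [← Matrix.trace_sum, ← Matrix.sum_mul, hL, one_mul, hρ.2]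

lemma channel_sum {d n : ℕ} {N : Mat d → Mat d} (hN : IsChannel N) (r : Fin n → ℝ)
    (ρ : Fin n → Mat d) : N (∑ k, r k • ρ k) = ∑ k, r k • N (ρ k) := by
  obtain ⟨n, L, hL, h⟩ := hN
  simp only [h, Matrix.mul_sum, Matrix.sum_mul, Finset.smul_sum, Matrix.mul_smul, Matrix.smul_mul]
  rw [Finset.sum_comm]

lemma density_sum {d n : ℕ} {p : Fin n → ℝ} (hp : IsProb p) {A : Fin n → Mat d}
    (hA : ∀ x, IsDensityMatrix (A x)) : IsDensityMatrix (∑ x, p x • A x) := by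
  refine ⟨psd_sum hp.1 fun x => (hA x).1, ?_⟩
  simp only [Matrix.trace_sum, Matrix.trace_smul, (hA _).2, Complex.real_smul, mul_one]
  exact_mod_cast hp.2

lemma eig_le_one {d : ℕ} {A : Mat d} (h : IsDensityMatrix A) (i : Fin d) :
    h.1.1.eigenvalues i ≤ 1 := by
  have h2 : ∑ i, h.1.1.eigenvalues i = 1 := by
    rw [← re_trace, h.2, Complex.one_re]
  rw [← h2]
  exact Finset.single_le_sum (fun i _ => h.1.eigenvalues_nonneg i) (Finset.mem_univ i)

lemma entropy_nonneg {d : ℕ} {A : Mat d} (h : IsDensityMatrix A) : 0 ≤ entropy A := by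
  rw [entropy, dif_pos h.1.1, neg_nonneg]
  exact Finset.sum_nonpos fun i _ => mul_nonpos_of_nonneg_of_nonpos (h.1.eigenvalues_nonneg i)
    (Real.logb_nonpos one_lt_two (h.1.eigenvalues_nonneg i) (eig_le_one h i))

lemma entropy_le {d : ℕ} {A : Mat d} (h : IsDensityMatrix A) :
    entropy A ≤ d / Real.log 2 := by
  have hlog : 0 < Real.log 2 := Real.log_pos one_lt_two
  rw [le_div_iff₀ hlog, entropy_mul_log h.1.1, ← Finset.sum_neg_distrib]
  have : ∀ i ∈ Finset.univ, -(h.1.1.eigenvalues i * Real.log (h.1.1.eigenvalues i)) ≤ (1 : ℝ) := by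
    intro i _
    have h1 := Real.negMulLog_le_one_sub_self (h.1.eigenvalues_nonneg i)
    have h2 := h.1.eigenvalues_nonneg i
    rw [Real.negMulLog] at h1
    linarith
  simpa using Finset.sum_le_card_nsmul _ _ _ this

lemma holevo_le_FEC {d : ℕ} (F : Set (Mat d)) {ρ : Mat d} (hρ : IsDensityMatrix ρ) {n : ℕ}
    {p : Fin n → ℝ} (hp : IsProb p) {N : Fin n → Mat d → Mat d}
    (hN : ∀ x, IsFreeChannel F (N x)) : holevo p (fun x => N x ρ) ≤ FEC F ρ := by
  refine le_csSup ⟨d / Real.log 2, ?_⟩ ⟨n, p, N, hp, hN, rfl⟩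
  rintro c ⟨n, p, N, hp, hN, rfl⟩
  have h1 : ∀ x, IsDensityMatrix (N x ρ) := fun x => channel_density (hN x).1 hρ
  have h2 := entropy_le (density_sum hp h1)
  have h3 : 0 ≤ ∑ x, p x * entropy (N x ρ) :=
    Finset.sum_nonneg fun x _ => mul_nonneg (hp.1 x) (entropy_nonneg (h1 x))
  rw [holevo]
  linarith

/-- (Convexity) For any set `F` of density matrices on `ℂ^d`, any finite
family of density matrices `{ρ_k}` and probability weights `{p_k}`, the free encoding
capacity satisfies `C_F(∑ₖ pₖ ρₖ) ≤ ∑ₖ pₖ C_F(ρₖ)`. -/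
theorem FEC_convex {d : ℕ} (F : Set (Mat d)) {n : ℕ} (p : Fin n → ℝ)
    (ρs : Fin n → Mat d) (hp : IsProb p) (hρ : ∀ k, IsDensityMatrix (ρs k)) :
    FEC F (∑ k, p k • ρs k) ≤ ∑ k, p k * FEC F (ρs k) := by
  refine csSup_le ?_ ?_
  · refine ⟨_, 1, fun _ => 1, fun _ => id, ⟨fun _ => zero_le_one, by simp⟩, fun _ => ⟨?_, ?_⟩, rfl⟩
    · exact ⟨1, fun _ => 1, by simp, by simp⟩
    · exact fun σ hσ => hσ
  · rintro c ⟨m, w, N, hw, hN, rfl⟩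
    simp only [channel_sum (hN _).1]
    refine (holevo_convex hw.1 hp.1 (A := fun k x => N x (ρs k))
      fun k x => (channel_density (hN x).1 (hρ k)).1).trans ?_
    exact Finset.sum_le_sum fun k _ =>
      mul_le_mul_of_nonneg_left (holevo_le_FEC F (hρ k) hw hN) (hp.1 k)

end FECpaper
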